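/- arXiv:2212.08393 — 4 statements merged into one kernel-verified Lean document; each statement's English description precedes it below -/
import Mathlib

section
/- Let A be a unital associative ring and let ℓ₁, ℓ₂, ℓ₃ be pairwise transverse A-lines in the right A-module A². For i ≠ j let a_{ji} : ℓᵢ → A²/ℓⱼ denote the restriction to ℓᵢ of the quotient map A² → A²/ℓⱼ (an isomorphism of right A-modules by transversality). Then the composition −a₃₁⁻¹ ∘ a₃₂ ∘ a₁₂⁻¹ ∘ a₁₃ ∘ a₂₃⁻¹ ∘ a₂₁ : ℓ₁ → ℓ₁ is the identity map of ℓ₁. -/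
/-- `(x, y)` is a basis of `A²` viewed as a right `A`-module: the map
`(a, b) ↦ x·a + y·b` is a bijection `A × A → A²`. -/
def IsBasis {A : Type*} [Ring A] (x y : Fin 2 → A) : Prop :=
  Function.Bijective fun p : A × A => fun i => x i * p.1 + y i * p.2

/-- The `A`-line `xA` spanned by `x ∈ A²`, as a right `A`-submodule,
i.e. a submodule over `Aᵐᵒᵖ`. -/
def line {A : Type*} [Ring A] (x : Fin 2 → A) : Submodule Aᵐᵒᵖ (Fin 2 → A) :=
  Submodule.span Aᵐᵒᵖ {x}

/-- For pairwise transverse `A`-lines `ℓ₁ = x₁A`, `ℓ₂ = x₂A`, `ℓ₃ = x₃A` in `A²`,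
with `a_{ji} : ℓᵢ → A²/ℓⱼ` the restrictions of the quotient maps (isomorphisms by
transversality), the composition `−a₃₁⁻¹ ∘ a₃₂ ∘ a₁₂⁻¹ ∘ a₁₃ ∘ a₂₃⁻¹ ∘ a₂₁` is the
identity of `ℓ₁`. -/
theorem triangle_composition_eq_id {A : Type*} [Ring A] (x₁ x₂ x₃ : Fin 2 → A)
    (h12 : IsBasis x₁ x₂) (h13 : IsBasis x₁ x₃) (h23 : IsBasis x₂ x₃)
    (a21 : line x₁ →ₗ[Aᵐᵒᵖ] (Fin 2 → A) ⧸ line x₂)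
    (ha21 : a21 = ((line x₂).mkQ).comp (line x₁).subtype)
    (a31 : line x₁ →ₗ[Aᵐᵒᵖ] (Fin 2 → A) ⧸ line x₃)
    (ha31 : a31 = ((line x₃).mkQ).comp (line x₁).subtype)
    (a12 : line x₂ →ₗ[Aᵐᵒᵖ] (Fin 2 → A) ⧸ line x₁)
    (ha12 : a12 = ((line x₁).mkQ).comp (line x₂).subtype)
    (a32 : line x₂ →ₗ[Aᵐᵒᵖ] (Fin 2 → A) ⧸ line x₃)
    (ha32 : a32 = ((line x₃).mkQ).comp (line x₂).subtype)
    (a13 : line x₃ →ₗ[Aᵐᵒᵖ] (Fin 2 → A) ⧸ line x₁)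
    (ha13 : a13 = ((line x₁).mkQ).comp (line x₃).subtype)
    (a23 : line x₃ →ₗ[Aᵐᵒᵖ] (Fin 2 → A) ⧸ line x₂)
    (ha23 : a23 = ((line x₂).mkQ).comp (line x₃).subtype)
    -- two-sided inverses of `a₃₁`, `a₁₂`, `a₂₃`
    (b31 : ((Fin 2 → A) ⧸ line x₃) →ₗ[Aᵐᵒᵖ] line x₁)
    (hb31l : Function.LeftInverse b31 a31) (hb31r : Function.RightInverse b31 a31)
    (b12 : ((Fin 2 → A) ⧸ line x₁) →ₗ[Aᵐᵒᵖ] line x₂)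
    (hb12l : Function.LeftInverse b12 a12) (hb12r : Function.RightInverse b12 a12)
    (b23 : ((Fin 2 → A) ⧸ line x₂) →ₗ[Aᵐᵒᵖ] line x₃)
    (hb23l : Function.LeftInverse b23 a23) (hb23r : Function.RightInverse b23 a23) :
    ∀ u : line x₁, -(b31 (a32 (b12 (a13 (b23 (a21 u)))))) = u := by
  intro u
  obtain ⟨w, hw⟩ : ∃ w, b23 (a21 u) = w := ⟨_, rfl⟩
  have hwu : (w : Fin 2 → A) - u ∈ line x₂ := by
    have h : a23 w = a21 u := by rw [← hw, hb23r]
    rw [ha23, ha21] at h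
    exact (Submodule.Quotient.eq _).1 h
  have hv : a13 w = a12 ⟨w - u, hwu⟩ := by
    rw [ha13, ha12]
    refine (Submodule.Quotient.eq _).2 ?_
    simp
  have hz : a32 ⟨w - u, hwu⟩ = a31 (-u) := by
    rw [ha32, ha31]
    refine (Submodule.Quotient.eq _).2 ?_
    simp
  rw [hw, hv, hb12l, hz, hb31l, neg_neg]
end

section
/- Let A be a unital associative ring and let ℓ₁, ℓ₂, ℓ₃ be pairwise transverse A-lines in the right A-module A². Then the Kashiwara–Maslov map satisfies μ₁²³ = −μ₁³², that is, a₁₃ ∘ a₂₃⁻¹ ∘ a₂₁ = −(a₁₂ ∘ a₃₂⁻¹ ∘ a₃₁) as maps ℓ₁ → A²/ℓ₁. -/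
/-- For pairwise transverse `A`-lines `ℓ₁ = x₁A`, `ℓ₂ = x₂A`, `ℓ₃ = x₃A` in `A²`,
the Kashiwara–Maslov map satisfies `μ₁²³ = −μ₁³²`, i.e.
`a₁₃ ∘ a₂₃⁻¹ ∘ a₂₁ = −(a₁₂ ∘ a₃₂⁻¹ ∘ a₃₁)` as maps `ℓ₁ → A²/ℓ₁`. -/
theorem kashiwaraMaslov_antisymm {A : Type*} [Ring A] (x₁ x₂ x₃ : Fin 2 → A)
    (h12 : IsBasis x₁ x₂) (h13 : IsBasis x₁ x₃) (h23 : IsBasis x₂ x₃)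
    (a21 : line x₁ →ₗ[Aᵐᵒᵖ] (Fin 2 → A) ⧸ line x₂)
    (ha21 : a21 = ((line x₂).mkQ).comp (line x₁).subtype)
    (a31 : line x₁ →ₗ[Aᵐᵒᵖ] (Fin 2 → A) ⧸ line x₃)
    (ha31 : a31 = ((line x₃).mkQ).comp (line x₁).subtype)
    (a12 : line x₂ →ₗ[Aᵐᵒᵖ] (Fin 2 → A) ⧸ line x₁)
    (ha12 : a12 = ((line x₁).mkQ).comp (line x₂).subtype)
    (a32 : line x₂ →ₗ[Aᵐᵒᵖ] (Fin 2 → A) ⧸ line x₃)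
    (ha32 : a32 = ((line x₃).mkQ).comp (line x₂).subtype)
    (a13 : line x₃ →ₗ[Aᵐᵒᵖ] (Fin 2 → A) ⧸ line x₁)
    (ha13 : a13 = ((line x₁).mkQ).comp (line x₃).subtype)
    (a23 : line x₃ →ₗ[Aᵐᵒᵖ] (Fin 2 → A) ⧸ line x₂)
    (ha23 : a23 = ((line x₂).mkQ).comp (line x₃).subtype)
    -- two-sided inverses of `a₂₃` and `a₃₂`
    (b23 : ((Fin 2 → A) ⧸ line x₂) →ₗ[Aᵐᵒᵖ] line x₃)
    (hb23l : Function.LeftInverse b23 a23) (hb23r : Function.RightInverse b23 a23)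
    (b32 : ((Fin 2 → A) ⧸ line x₃) →ₗ[Aᵐᵒᵖ] line x₂)
    (hb32l : Function.LeftInverse b32 a32) (hb32r : Function.RightInverse b32 a32) :
    ∀ u : line x₁, a13 (b23 (a21 u)) = -(a12 (b32 (a31 u))) := by
  subst ha21 ha31 ha12 ha32 ha13 ha23
  intro u
  set w := b23 (((line x₂).mkQ.comp (line x₁).subtype) u)
  have hmem : (u : Fin 2 → A) - w ∈ line x₂ :=
    (Submodule.Quotient.eq _).1 (hb23r _).symm
  have hv : b32 (((line x₃).mkQ.comp (line x₁).subtype) u) = ⟨u - w, hmem⟩ := by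
    rw [← hb32l ⟨u - w, hmem⟩]
    refine congrArg b32 ((Submodule.Quotient.eq _).2 ?_)
    simp
  rw [hv, eq_neg_iff_add_eq_zero]
  change (line x₁).mkQ w + (line x₁).mkQ (u - w) = 0
  rw [← map_add, add_sub_cancel]
  simp
end

section
/- Let A be a unital associative ring and let v₁, v₂, v₃ ∈ A² be such that each pair (vᵢ, vⱼ), i ≠ j, is a basis of the right A-module A². For each i, fix ŵᵢ ∈ A² such that (vᵢ, ŵᵢ) is a basis of A², and for each ordered pair (i,j) with i ≠ j write v_j = ŵᵢ a_{i,j} + vᵢ r_{i,j} with a_{i,j} ∈ A and r_{i,j} ∈ A (then each a_{i,j} is invertible). Then the triangle relation holds in its untwisted linear-algebra form: a_{1,3} · a_{2,3}⁻¹ · a_{2,1} = − a_{1,2} · a_{3,2}⁻¹ · a_{3,1}. (In the twisted local-system setting of the paper this is the relation a_{γ₃} a_{γ̄₂}⁻¹ a_{γ₁} = a_{γ̄₁} a_{γ₂}⁻¹ a_{γ̄₃} between the noncommutative 𝒜-coordinates of an oriented triangle; the sign is absorbed by the twisting.) -/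
theorem IsBasis.eq_and_eq {A : Type*} [Ring A] {x y : Fin 2 → A} (h : IsBasis x y)
    {a b c d : A} (e : ∀ k, x k * a + y k * b = x k * c + y k * d) : a = c ∧ b = d :=
  Prod.ext_iff.mp (h.1 (a₁ := (a, b)) (a₂ := (c, d)) (funext e))

theorem IsBasis.exists_eq_add {A : Type*} [Ring A] {x y : Fin 2 → A} (h : IsBasis x y)
    (z : Fin 2 → A) : ∃ a b : A, ∀ k, z k = x k * a + y k * b := by
  obtain ⟨⟨a, b⟩, e⟩ := h.2 z
  exact ⟨a, b, fun k => (congrFun e k).symm⟩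

/-- If `(v, w)` and `(v, u)` are bases, then the coordinate of `u` along `w` is invertible. -/
theorem IsBasis.isUnit_coord {A : Type*} [Ring A] {v w u : Fin 2 → A} (hw : IsBasis v w)
    (hu : IsBasis v u) {a r : A} (e : ∀ k, u k = w k * a + v k * r) : IsUnit a := by
  obtain ⟨c, d, f⟩ := hu.exists_eq_add w
  have had : 0 = c + r * d ∧ 1 = a * d := hw.eq_and_eq fun k => by
    calc v k * 0 + w k * 1 = v k * c + u k * d := by simpa using f k
      _ = v k * (c + r * d) + w k * (a * d) := by rw [e k]; noncomm_ring
  have hda : 0 = c * a + r ∧ 1 = d * a := hu.eq_and_eq fun k => by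
    calc v k * 0 + u k * 1 = w k * a + v k * r := by simpa using e k
      _ = v k * (c * a + r) + u k * (d * a) := by rw [f k]; noncomm_ring
  exact ⟨⟨a, d, had.2.symm, hda.2.symm⟩, rfl⟩

/-- Triangle relation for noncommutative `𝒜`-coordinates (untwisted linear-algebra
form): given `v₁, v₂, v₃ ∈ A²` pairwise forming bases of the right `A`-module `A²`,
`ŵᵢ` with `(vᵢ, ŵᵢ)` a basis, and `a_{i,j}` defined by `v_j = ŵᵢ a_{i,j} + vᵢ r_{i,j}`,
each `a_{i,j}` is invertible and
`a_{1,3} a_{2,3}⁻¹ a_{2,1} = − a_{1,2} a_{3,2}⁻¹ a_{3,1}`. -/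
theorem triangle_relation {A : Type*} [Ring A]
    (v₁ v₂ v₃ w₁ w₂ w₃ : Fin 2 → A)
    (h12 : IsBasis v₁ v₂) (h13 : IsBasis v₁ v₃) (h23 : IsBasis v₂ v₃)
    (h21 : IsBasis v₂ v₁) (h31 : IsBasis v₃ v₁) (h32 : IsBasis v₃ v₂)
    (hw₁ : IsBasis v₁ w₁) (hw₂ : IsBasis v₂ w₂) (hw₃ : IsBasis v₃ w₃)
    (a12 a13 a21 a23 a31 a32 r12 r13 r21 r23 r31 r32 : A)
    (hd12 : v₂ = fun k => w₁ k * a12 + v₁ k * r12)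
    (hd13 : v₃ = fun k => w₁ k * a13 + v₁ k * r13)
    (hd21 : v₁ = fun k => w₂ k * a21 + v₂ k * r21)
    (hd23 : v₃ = fun k => w₂ k * a23 + v₂ k * r23)
    (hd31 : v₁ = fun k => w₃ k * a31 + v₃ k * r31)
    (hd32 : v₂ = fun k => w₃ k * a32 + v₃ k * r32) :
    (IsUnit a12 ∧ IsUnit a13 ∧ IsUnit a21 ∧ IsUnit a23 ∧ IsUnit a31 ∧ IsUnit a32) ∧
      ∀ b23 b32 : A, a23 * b23 = 1 → b23 * a23 = 1 → a32 * b32 = 1 → b32 * a32 = 1 →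
        a13 * b23 * a21 = -(a12 * b32 * a31) := by
  replace hd12 := congrFun hd12
  replace hd13 := congrFun hd13
  replace hd21 := congrFun hd21
  replace hd23 := congrFun hd23
  replace hd31 := congrFun hd31
  replace hd32 := congrFun hd32
  have u21 : IsUnit a21 := hw₂.isUnit_coord h21 hd21
  refine ⟨⟨hw₁.isUnit_coord h12 hd12, hw₁.isUnit_coord h13 hd13, u21,
    hw₂.isUnit_coord h23 hd23, hw₃.isUnit_coord h31 hd31, hw₃.isUnit_coord h32 hd32⟩, ?_⟩
  intro b23 b32 hb23 _ _ hb32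
  obtain ⟨x, y, hxy⟩ := h12.exists_eq_add v₃
  have e1 : r13 = x + r12 * y ∧ a13 = a12 * y := hw₁.eq_and_eq fun k => by
    calc v₁ k * r13 + w₁ k * a13 = v₁ k * x + v₂ k * y := by rw [← hxy k, hd13 k, add_comm]
      _ = v₁ k * (x + r12 * y) + w₁ k * (a12 * y) := by rw [hd12 k]; noncomm_ring
  have e2 : r23 = r21 * x + y ∧ a23 = a21 * x := hw₂.eq_and_eq fun k => by
    calc v₂ k * r23 + w₂ k * a23 = v₁ k * x + v₂ k * y := by rw [← hxy k, hd23 k, add_comm]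
      _ = v₂ k * (r21 * x + y) + w₂ k * (a21 * x) := by rw [hd21 k]; noncomm_ring
  have e3 : 1 = r31 * x + r32 * y ∧ 0 = a31 * x + a32 * y := hw₃.eq_and_eq fun k => by
    calc v₃ k * 1 + w₃ k * 0 = v₁ k * x + v₂ k * y := by simpa using hxy k
      _ = v₃ k * (r31 * x + r32 * y) + w₃ k * (a31 * x + a32 * y) := by
        rw [hd31 k, hd32 k]; noncomm_ring
  have hx : x * b23 * a21 = 1 := u21.mul_left_cancel <| by
    rw [← mul_assoc, ← mul_assoc, ← e2.2, hb23, one_mul, mul_one]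
  have hy : b32 * a31 * x = -y := by
    rw [mul_assoc, eq_neg_of_add_eq_zero_left e3.2.symm, mul_neg, ← mul_assoc, hb32, one_mul]
  have key : b32 * a31 = -(y * b23 * a21) := by
    calc b32 * a31 = b32 * a31 * (x * b23 * a21) := by rw [hx, mul_one]
      _ = b32 * a31 * x * b23 * a21 := by simp only [mul_assoc]
      _ = -(y * b23 * a21) := by rw [hy, neg_mul, neg_mul]
  rw [mul_assoc a12, key, e1.2, mul_neg, neg_neg]
  simp only [mul_assoc]
end

section
/- Let (A,σ) be an involutive ℝ-algebra and let ω(x,y) = σ(x₁)y₂ − σ(x₂)y₁ be the standard symplectic form on A². Let v₁, v₂, v₃ ∈ A² satisfy ω(vᵢ, vᵢ) = 0 for all i and ω(vᵢ, vⱼ) ∈ A^× for all i ≠ j, and assume (v₁, v₂) is a basis of the right A-module A². Then the element β := ω(v₁, v₃) · ω(v₂, v₃)⁻¹ · ω(v₂, v₁) is σ-symmetric: σ(β) = β. (This is the element β_T = a_{γ₃} a_{γ̄₂}⁻¹ a_{γ₁} ∈ A^σ attached to an oriented triangle T of the triangulation for a decorated twisted symplectic local system.) -/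
/-- Let `(A, σ)` be an involutive `ℝ`-algebra and let
`ω(x, y) = σ(x₀)y₁ − σ(x₁)y₀` be the standard symplectic form on `A²`.
If `v₁, v₂, v₃ ∈ A²` satisfy `ω(vᵢ, vᵢ) = 0` for all `i`, `ω(vᵢ, vⱼ) ∈ A^×` for all
`i ≠ j`, and `(v₁, v₂)` is a basis of the right `A`-module `A²`, then the element
`β = ω(v₁,v₃) · ω(v₂,v₃)⁻¹ · ω(v₂,v₁)` is `σ`-symmetric: `σ(β) = β`. -/
theorem triangle_invariant_symmetric {A : Type*} [Ring A] [Algebra ℝ A]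
    (σ : A →ₗ[ℝ] A)
    (hσmul : ∀ a b : A, σ (a * b) = σ b * σ a)
    (hσinv : ∀ a : A, σ (σ a) = a)
    (ω : (Fin 2 → A) → (Fin 2 → A) → A)
    (hω : ∀ x y : Fin 2 → A, ω x y = σ (x 0) * y 1 - σ (x 1) * y 0)
    (v₁ v₂ v₃ : Fin 2 → A)
    (hiso1 : ω v₁ v₁ = 0) (hiso2 : ω v₂ v₂ = 0) (hiso3 : ω v₃ v₃ = 0)
    (hu12 : IsUnit (ω v₁ v₂)) (hu13 : IsUnit (ω v₁ v₃)) (hu23 : IsUnit (ω v₂ v₃))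
    (hu21 : IsUnit (ω v₂ v₁)) (hu31 : IsUnit (ω v₃ v₁)) (hu32 : IsUnit (ω v₃ v₂))
    (hbasis : IsBasis v₁ v₂) :
    ∀ b : A, ω v₂ v₃ * b = 1 → b * ω v₂ v₃ = 1 →
      σ (ω v₁ v₃ * b * ω v₂ v₁) = ω v₁ v₃ * b * ω v₂ v₁ := by
  intro b hb _
  obtain ⟨⟨p, q⟩, hpq⟩ := hbasis.2 v₃
  have h0 : v₃ 0 = v₁ 0 * p + v₂ 0 * q := (congrFun hpq 0).symm
  have h1 : v₃ 1 = v₁ 1 * p + v₂ 1 * q := (congrFun hpq 1).symm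
  have hσone : σ 1 = 1 := by
    have h := hσmul (σ 1) 1
    rw [mul_one, hσinv, mul_one] at h
    exact h.symm
  have hanti (x y : Fin 2 → A) : σ (ω x y) = -ω y x := by
    simp only [hω, map_sub, hσmul, hσinv]
    abel
  have hright (x : Fin 2 → A) : ω x v₃ = ω x v₁ * p + ω x v₂ * q := by
    simp only [hω, h0, h1]
    noncomm_ring
  have h13 : ω v₁ v₃ = ω v₁ v₂ * q := by rw [hright, hiso1, zero_mul, zero_add]
  have h23 : ω v₂ v₃ = ω v₂ v₁ * p := by rw [hright, hiso2, zero_mul, add_zero]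
  have h31 : ω v₃ v₁ = σ q * ω v₂ v₁ := by
    rw [← neg_neg (ω v₃ v₁), ← hanti, h13, hσmul, hanti, mul_neg, neg_neg]
  have h32 : ω v₃ v₂ = σ p * ω v₁ v₂ := by
    rw [← neg_neg (ω v₃ v₂), ← hanti, h23, hσmul, hanti, mul_neg, neg_neg]
  have hsymm : σ p * ω v₁ v₂ * q = -(σ q * ω v₂ v₁ * p) := by
    rw [hright, h31, h32] at hiso3
    exact eq_neg_of_add_eq_zero_right hiso3
  rw [h23] at hb
  have hpc : p * (b * ω v₂ v₁) = 1 := hu21.mul_left_cancel <| by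
    rw [← mul_assoc, ← mul_assoc, hb, one_mul, mul_one]
  rw [mul_assoc, h13]
  generalize b * ω v₂ v₁ = c at hpc ⊢
  have hσpc : σ c * σ p = 1 := by rw [← hσmul, hpc, hσone]
  calc σ (ω v₁ v₂ * q * c) = σ c * -(σ q * ω v₂ v₁ * (p * c)) := by
        simp only [hσmul, hanti, hpc, mul_one, mul_neg]
    _ = σ c * (-(σ q * ω v₂ v₁ * p) * c) := by rw [neg_mul, mul_assoc _ p c]
    _ = σ c * σ p * (ω v₁ v₂ * q * c) := by rw [← hsymm]; simp only [mul_assoc]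
    _ = ω v₁ v₂ * q * c := by rw [hσpc, one_mul]
end
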